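/- Let v = (v_p)_{p ∈ ℝᵐ} be a Schwartz family of tempered distributions on ℝⁿ. Then the associated linear operator v̂ : 𝓢(ℝⁿ, ℂ) → 𝓢(ℝᵐ, ℂ), φ ↦ (p ↦ v_p(φ)), is continuous when both Schwartz spaces carry their usual (strong, Fréchet) topologies. -/

import Mathlib

open Filter Topology
open scoped LineDeriv SchwartzMap ContDiff

namespace SchwartzMap

section Complete

variable {E F : Type*} [NormedAddCommGroup E] [NormedSpace ℝ E]
  [NormedAddCommGroup F] [NormedSpace ℝ F]

theorem exists_seminorm_sub_le_of_cauchySeq {u : ℕ → 𝓢(E, F)} (hu : CauchySeq u) (k l : ℕ)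
    {ε : ℝ} (hε : 0 < ε) :
    ∃ N, ∀ i ≥ N, ∀ j ≥ N, SchwartzMap.seminorm ℝ k l (u i - u j) ≤ ε := by
  have hq : Continuous (SchwartzMap.seminorm ℝ k l : Seminorm ℝ 𝓢(E, F)) :=
    (schwartz_withSeminorms ℝ E F).continuous_seminorm (k, l)
  have hsub : Tendsto (fun p : ℕ × ℕ ↦ u p.2 - u p.1) atTop (𝓝 0) := by
    rw [cauchySeq_iff_tendsto, uniformity_eq_comap_nhds_zero, tendsto_comap_iff] at hu
    exact hu
  have hlim := (hq.tendsto 0).comp hsub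
  rw [map_zero] at hlim
  obtain ⟨⟨N, M⟩, hN⟩ := eventually_atTop.1 (hlim.eventually (ge_mem_nhds hε))
  refine ⟨max N M, fun i hi j hj ↦ hN (j, i) ⟨?_, ?_⟩⟩
  · exact (le_max_left _ _).trans hj
  · exact (le_max_right _ _).trans hi

theorem norm_pow_mul_norm_iteratedFDeriv_sub_le (f g : 𝓢(E, F)) (k l : ℕ) (x : E) :
    ‖x‖ ^ k * ‖iteratedFDeriv ℝ l f x - iteratedFDeriv ℝ l g x‖ ≤
      SchwartzMap.seminorm ℝ k l (f - g) := by
  have h : iteratedFDeriv ℝ l (f - g) x = iteratedFDeriv ℝ l f x - iteratedFDeriv ℝ l g x :=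
    iteratedFDeriv_sub_apply (f.smooth l).contDiffAt (g.smooth l).contDiffAt
  rw [← h]
  exact le_seminorm ℝ k l (f - g) x

variable [CompleteSpace F]

theorem exists_iteratedFDeriv_limit_of_cauchySeq {u : ℕ → 𝓢(E, F)} (hu : CauchySeq u) :
    ∃ p : E → FormalMultilinearSeries ℝ E F,
      (∀ l x, Tendsto (fun i ↦ iteratedFDeriv ℝ l (u i) x) atTop (𝓝 (p x l))) ∧
      ∀ k l, ∀ ε > 0, ∃ N, ∀ i ≥ N, ∀ x,
        ‖x‖ ^ k * ‖iteratedFDeriv ℝ l (u i) x - p x l‖ ≤ ε := by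
  have hlim : ∀ x l, ∃ a, Tendsto (fun i ↦ iteratedFDeriv ℝ l (u i) x) atTop (𝓝 a) := by
    intro x l
    refine cauchySeq_tendsto_of_complete (Metric.cauchySeq_iff.2 fun ε hε ↦ ?_)
    obtain ⟨N, hN⟩ := exists_seminorm_sub_le_of_cauchySeq hu 0 l (half_pos hε)
    refine ⟨N, fun i hi j hj ↦ ?_⟩
    have h := (norm_pow_mul_norm_iteratedFDeriv_sub_le (u i) (u j) 0 l x).trans (hN i hi j hj)
    rw [pow_zero, one_mul] at h
    rw [dist_eq_norm]
    linarith
  choose p hp using hlim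
  refine ⟨p, fun l x ↦ hp x l, fun k l ε hε ↦ ?_⟩
  obtain ⟨N, hN⟩ := exists_seminorm_sub_le_of_cauchySeq hu k l hε
  refine ⟨N, fun i hi x ↦ ?_⟩
  refine le_of_tendsto (((tendsto_const_nhds.sub (hp x l)).norm).const_mul _)
    ((eventually_ge_atTop N).mono fun j hj ↦ ?_)
  exact (norm_pow_mul_norm_iteratedFDeriv_sub_le (u i) (u j) k l x).trans (hN i hi j hj)

theorem exists_tendsto_of_cauchySeq {u : ℕ → 𝓢(E, F)} (hu : CauchySeq u) :
    ∃ f, Tendsto u atTop (𝓝 f) := by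
  obtain ⟨p, hp, hdist⟩ := exists_iteratedFDeriv_limit_of_cauchySeq hu
  have hunif : ∀ l, TendstoUniformly (fun i x ↦ iteratedFDeriv ℝ l (u i) x)
      (fun x ↦ p x l) atTop := by
    intro l
    refine Metric.tendstoUniformly_iff.2 fun ε hε ↦ ?_
    obtain ⟨N, hN⟩ := hdist 0 l (ε / 2) (half_pos hε)
    refine (eventually_ge_atTop N).mono fun i hi x ↦ ?_
    have h := hN i hi x
    rw [pow_zero, one_mul] at h
    rw [dist_comm, dist_eq_norm]
    linarith
  have hderiv : ∀ l x, HasFDerivAt (fun y ↦ p y l) (p x (l + 1)).curryLeft x := by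
    intro l x
    refine hasFDerivAt_of_tendstoUniformly (f := fun i y ↦ iteratedFDeriv ℝ l (u i) y)
      (f' := fun i y ↦ (iteratedFDeriv ℝ (l + 1) (u i) y).curryLeft)
      (g' := fun y ↦ (p y (l + 1)).curryLeft) (l := atTop) ?_ ?_ (hp l) x
    · exact (continuousMultilinearCurryLeftEquiv ℝ (fun _ : Fin (l + 1) ↦ E)
        F).isometry.uniformContinuous.comp_tendstoUniformly (hunif (l + 1))
    · intro i y
      exact ((u i).smooth ⊤).ftaylorSeries.fderiv l (by exact_mod_cast ENat.natCast_lt_top l) y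
  have htaylor : HasFTaylorSeriesUpTo ∞ (fun x ↦ (p x 0).curry0) p :=
    { zero_eq := fun _ ↦ rfl
      fderiv := fun l _ x ↦ hderiv l x
      cont := fun l _ ↦ continuous_iff_continuousAt.2 fun x ↦ (hderiv l x).continuousAt }
  have hiter : ∀ l x, p x l = iteratedFDeriv ℝ l (fun y ↦ (p y 0).curry0) x := fun l x ↦
    htaylor.eq_iteratedFDeriv (by exact_mod_cast le_top) x
  let f : 𝓢(E, F) :=
    { toFun := fun x ↦ (p x 0).curry0
      smooth' := htaylor.contDiff
      decay' := by
        intro k l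
        obtain ⟨N, hN⟩ := hdist k l 1 one_pos
        refine ⟨1 + SchwartzMap.seminorm ℝ k l (u N), fun x ↦ ?_⟩
        rw [← hiter]
        calc ‖x‖ ^ k * ‖p x l‖
            ≤ ‖x‖ ^ k * (‖iteratedFDeriv ℝ l (u N) x - p x l‖ +
                ‖iteratedFDeriv ℝ l (u N) x‖) := by
              gcongr
              rw [norm_sub_rev]
              exact norm_le_norm_sub_add _ _
          _ ≤ 1 + SchwartzMap.seminorm ℝ k l (u N) := by
              rw [mul_add]
              exact add_le_add (hN N le_rfl x) (le_seminorm ℝ k l (u N) x) }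
  refine ⟨f, ((schwartz_withSeminorms ℝ E F).tendsto_nhds_atTop u f).2 ?_⟩
  rintro ⟨k, l⟩ ε hε
  obtain ⟨N, hN⟩ := hdist k l (ε / 2) (half_pos hε)
  refine ⟨N, fun i hi ↦ lt_of_le_of_lt ?_ (half_lt_self hε)⟩
  refine seminorm_le_bound ℝ k l _ (half_pos hε).le fun x ↦ ?_
  have h : iteratedFDeriv ℝ l (u i - f) x = iteratedFDeriv ℝ l (u i) x - p x l := by
    rw [hiter]
    exact iteratedFDeriv_sub_apply ((u i).smooth l).contDiffAt (f.smooth l).contDiffAt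
  exact h ▸ hN i hi x

instance : (uniformity 𝓢(E, F)).IsCountablyGenerated :=
  IsUniformAddGroup.uniformity_countably_generated

instance : CompleteSpace 𝓢(E, F) :=
  UniformSpace.complete_of_cauchySeq_tendsto fun _ ↦ exists_tendsto_of_cauchySeq

instance : BaireSpace 𝓢(E, F) :=
  letI := UniformSpace.pseudoMetricSpace 𝓢(E, F)
  inferInstance

end Complete

section Barrelled

variable {V E F : Type*} [AddCommGroup V] [Module ℝ V] [UniformSpace V] [IsUniformAddGroup V]
  [ContinuousSMul ℝ V] [BarrelledSpace ℝ V]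
  [NormedAddCommGroup E] [NormedSpace ℝ E] [NormedAddCommGroup F] [NormedSpace ℝ F]

theorem continuous_lineDerivOp_apply_of_continuous_apply (T : V →ₗ[ℝ] 𝓢(E, F))
    (hT : ∀ x, Continuous fun φ ↦ T φ x) (h x : E) : Continuous fun φ ↦ (∂_{h} (T φ)) x := by
  let δ (y : E) : V →L[ℝ] F :=
    { toFun := fun φ ↦ T φ y
      map_add' := fun φ ψ ↦ by simp
      map_smul' := fun c φ ↦ by simp
      cont := hT y }
  refine (continuousLinearMapOfTendsto (l := 𝓝[≠] (0 : ℝ))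
    (fun t : ℝ ↦ t⁻¹ • (δ (x + t • h) - δ x)) (f := fun φ ↦ (∂_{h} (T φ)) x) ?_).continuous
  refine tendsto_pi_nhds.2 fun φ ↦ ?_
  rw [lineDerivOp_apply_eq_fderiv]
  exact ((T φ).hasFDerivAt x).hasLineDerivAt h |>.tendsto_slope_zero

theorem continuous_iteratedLineDerivOp_apply_of_continuous_apply (T : V →ₗ[ℝ] 𝓢(E, F))
    (hT : ∀ x, Continuous fun φ ↦ T φ x) {l : ℕ} (h : Fin l → E) (x : E) :
    Continuous fun φ ↦ (∂^{h} (T φ)) x := by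
  induction l generalizing x with
  | zero => simpa using hT x
  | succ l ih =>
    let S : V →ₗ[ℝ] 𝓢(E, F) :=
      (LineDeriv.iteratedLineDerivOpCLM ℝ 𝓢(E, F) (Fin.tail h)).toLinearMap ∘ₗ T
    exact continuous_lineDerivOp_apply_of_continuous_apply S (ih (Fin.tail h)) (h 0) x

/-- A linear map from a barrelled space to a Schwartz space is continuous as soon as it is
continuous for the topology of pointwise convergence on the target. -/
theorem continuous_of_continuous_apply (T : V →ₗ[ℝ] 𝓢(E, F))
    (hT : ∀ x, Continuous fun φ ↦ T φ x) : Continuous T := by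
  refine (schwartz_withSeminorms ℝ E F).continuous_of_continuous_comp T fun ⟨k, l⟩ ↦ ?_
  refine Seminorm.continuous_of_lowerSemicontinuous _
    (lowerSemicontinuous_iff_isClosed_preimage.2 fun a ↦ ?_)
  rcases lt_or_ge a 0 with ha | ha
  · convert isClosed_empty
    exact Set.eq_empty_of_forall_notMem fun φ hφ ↦ (hφ.trans_lt ha).not_ge (apply_nonneg _ φ)
  have hset : ((SchwartzMap.seminorm ℝ k l).comp T) ⁻¹' Set.Iic a =
      ⋂ (x : E) (h : Fin l → E), {φ | ‖x‖ ^ k * ‖(∂^{h} (T φ)) x‖ ≤ a * ∏ i, ‖h i‖} := by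
    ext φ
    simp only [Set.mem_preimage, Set.mem_Iic, Seminorm.comp_apply, Set.mem_iInter,
      Set.mem_ofPred_eq, iteratedLineDerivOp_eq_iteratedFDeriv]
    constructor
    · intro hφ x h
      calc ‖x‖ ^ k * ‖iteratedFDeriv ℝ l (T φ) x h‖
          ≤ ‖x‖ ^ k * (‖iteratedFDeriv ℝ l (T φ) x‖ * ∏ i, ‖h i‖) := by
            gcongr
            exact ContinuousMultilinearMap.le_opNorm _ h
        _ ≤ a * ∏ i, ‖h i‖ := by
            rw [← mul_assoc]
            gcongr
            exact (le_seminorm ℝ k l (T φ) x).trans hφ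
    · intro hφ
      refine seminorm_le_bound ℝ k l (T φ) ha fun x ↦ ?_
      have h := ContinuousMultilinearMap.opNorm_le_bound
        (f := ‖x‖ ^ k • iteratedFDeriv ℝ l (T φ) x) ha fun h ↦ by
          simpa [norm_smul] using hφ x h
      simpa [norm_smul] using h
  refine hset ▸ isClosed_iInter fun x ↦ isClosed_iInter fun h ↦ isClosed_le ?_ continuous_const
  exact continuous_const.mul
    (continuous_iteratedLineDerivOp_apply_of_continuous_apply T hT h x).norm

end Barrelled

end SchwartzMap

/-- Let `v = (v_p)_{p ∈ ℝᵐ}` be a Schwartz family of tempered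
distributions on `ℝⁿ`, with associated operator `vhat : 𝓢(ℝⁿ) → 𝓢(ℝᵐ)`,
`vhat φ p = v p φ`.  Then `vhat` is continuous for the usual (strong, Fréchet)
topologies of the Schwartz spaces. -/
theorem statement1 (n m : ℕ)
    (v : EuclideanSpace ℝ (Fin m) →
      (SchwartzMap (EuclideanSpace ℝ (Fin n)) ℂ →L[ℂ] ℂ))
    (vhat : SchwartzMap (EuclideanSpace ℝ (Fin n)) ℂ →
      SchwartzMap (EuclideanSpace ℝ (Fin m)) ℂ)
    (hv : ∀ (φ : SchwartzMap (EuclideanSpace ℝ (Fin n)) ℂ)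
      (p : EuclideanSpace ℝ (Fin m)), vhat φ p = v p φ) :
    Continuous vhat := by
  let T : 𝓢(EuclideanSpace ℝ (Fin n), ℂ) →ₗ[ℝ] 𝓢(EuclideanSpace ℝ (Fin m), ℂ) :=
    { toFun := vhat
      map_add' := fun φ ψ ↦ by ext p; simp [hv]
      map_smul' := fun c φ ↦ by
        ext p
        simp only [hv, smul_apply, RingHom.id_apply]
        exact ((v p).restrictScalars ℝ).map_smul c φ }
  refine SchwartzMap.continuous_of_continuous_apply T fun p ↦ ?_
  exact (v p).continuous.congr fun φ ↦ (hv φ p).symm
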